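/- arXiv:2512.01900 — 2 statements merged into one kernel-verified Lean document; each statement's English description precedes it below -/
import Mathlib

section
/- For every f : S → ℤ/2ℤ, all i, j ∈ ℕ and every x ∈ S: f⁽³⁾_{i,j}(x) = Σ_{y ⪯ x} [ |{q ∈ {1,…,k} : x_q ∈ classC and y_q ∈ classC}| = i ] · [ |{q ∈ {1,…,k} : x_q = D and y_q = D}| = j ] · f(y), where the sum is over the componentwise order ⪯ generated by 𝟎 < D < D* < C⁺ < C* and 𝟎 < C < C⁺. -/
/-- The six states `𝟎, D, D*, C, C⁺, C*`. -/
inductive S0 : Type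
  | O | D | Ds | C | Cp | Cs
  deriving DecidableEq

instance : Fintype S0 where
  elems := ⟨[S0.O, S0.D, S0.Ds, S0.C, S0.Cp, S0.Cs], by decide⟩
  complete := by intro x; cases x <;> decide

/-- The order `≤` on states, generated by `𝟎 < D < D* < C⁺ < C*` and `𝟎 < C < C⁺`. -/
def le0 : S0 → S0 → Bool
  | .O, _ => true
  | .D, .D => true | .D, .Ds => true | .D, .Cp => true | .D, .Cs => true
  | .Ds, .Ds => true | .Ds, .Cp => true | .Ds, .Cs => true
  | .C, .C => true | .C, .Cp => true | .C, .Cs => true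
  | .Cp, .Cp => true | .Cp, .Cs => true
  | .Cs, .Cs => true
  | _, _ => false

/-- The order `≤₁`: `a ≤₁ b` iff `a = b` or `b = C*`. -/
def le1 : S0 → S0 → Bool := fun a b => a == b || b == .Cs

/-- The order `≤₂`: `a ≤₂ b` iff `a = b`, or `b = C⁺` and `a ∈ {𝟎, D, D*, C}`, or `b = D*`
and `a ∈ {𝟎, D}`, or `b = C` and `a = 𝟎`. -/
def le2 : S0 → S0 → Bool := fun a b =>
  a == b || (b == .Cp && (a == .O || a == .D || a == .Ds || a == .C)) ||
    (b == .Ds && (a == .O || a == .D)) || (b == .C && a == .O)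

/-- The order `≤₃`: `a ≤₃ b` iff `a = b`, or `a = 𝟎` and `b = D`. -/
def le3 : S0 → S0 → Bool := fun a b => a == b || (a == .O && b == .D)

/-- The commutative join operation `⋈` on states. -/
def jn : S0 → S0 → S0
  | .O, a => a
  | a, .O => a
  | .Cs, _ => .Cs
  | _, .Cs => .Cs
  | .D, .D => .Ds | .D, .Ds => .Ds | .Ds, .D => .Ds | .Ds, .Ds => .Ds
  | .D, .C => .Cp | .D, .Cp => .Cp | .Ds, .C => .Cp | .Ds, .Cp => .Cp
  | .C, .D => .Cp | .Cp, .D => .Cp | .C, .Ds => .Cp | .Cp, .Ds => .Cp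
  | .C, .C => .Cs | .C, .Cp => .Cs | .Cp, .C => .Cs | .Cp, .Cp => .Cs

/-- The zeta matrix of the componentwise order induced by a base relation `r` on `S0`:
its `(x, y)` entry is `1` if `y ⊑ x` and `0` otherwise. -/
def zMat (k : ℕ) (r : S0 → S0 → Bool) : Matrix (Fin k → S0) (Fin k → S0) (ZMod 2) :=
  Matrix.of fun x y => if ∀ q, r (y q) (x q) = true then 1 else 0

/-- The zeta transform `ζf(x) = Σ_{y ⊑ x} f(y)` of the componentwise order of `r`. -/
def zetaT (k : ℕ) (r : S0 → S0 → Bool) (f : (Fin k → S0) → ZMod 2) :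
    (Fin k → S0) → ZMod 2 :=
  (zMat k r).mulVec f

/-- The Möbius transform of the componentwise order of `r`: the inverse of the zeta
transform. -/
noncomputable def muT (k : ℕ) (r : S0 → S0 → Bool) (f : (Fin k → S0) → ZMod 2) :
    (Fin k → S0) → ZMod 2 :=
  (zMat k r)⁻¹.mulVec f

/-- The number of coordinates of `x` whose state is in `classC = {C, C⁺}`. -/
def cardC (k : ℕ) (x : Fin k → S0) : ℕ :=
  (Finset.univ.filter fun q => x q = S0.C ∨ x q = S0.Cp).card

/-- The number of coordinates of `x` whose state is in `classD = {D}`. -/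
def cardD (k : ℕ) (x : Fin k → S0) : ℕ :=
  (Finset.univ.filter fun q => x q = S0.D).card

/-- The number of coordinates where both `x` and `y` have a state in `classC`. -/
def cardCC (k : ℕ) (x y : Fin k → S0) : ℕ :=
  (Finset.univ.filter fun q => (x q = S0.C ∨ x q = S0.Cp) ∧ (y q = S0.C ∨ y q = S0.Cp)).card

/-- The number of coordinates where both `x` and `y` have state `D`. -/
def cardDD (k : ℕ) (x y : Fin k → S0) : ℕ :=
  (Finset.univ.filter fun q => x q = S0.D ∧ y q = S0.D).card

/-- The filter `f|ᵢ^{classC}`. -/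
def restrC (k : ℕ) (i : ℕ) (f : (Fin k → S0) → ZMod 2) : (Fin k → S0) → ZMod 2 :=
  fun x => if cardC k x = i then f x else 0

/-- The filter `f|ⱼ^{classD}`. -/
def restrD (k : ℕ) (j : ℕ) (f : (Fin k → S0) → ZMod 2) : (Fin k → S0) → ZMod 2 :=
  fun x => if cardD k x = j then f x else 0

/-- `f⁽³⁾_{i,j} = ζ₃ ((ζ₂ ((ζ₁ f)|ᵢ^{classC}))|ⱼ^{classD})`. -/
def F3 (k : ℕ) (f : (Fin k → S0) → ZMod 2) (i j : ℕ) : (Fin k → S0) → ZMod 2 :=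
  zetaT k le3 (restrD k j (zetaT k le2 (restrC k i (zetaT k le1 f))))

/-- `h⁽³⁾_{i,j} = Σ_{i₁+i₂=i, j₁+j₂=j} f⁽³⁾_{i₁,j₁} · g⁽³⁾_{i₂,j₂}` (pointwise product). -/
def H3 (k : ℕ) (f g : (Fin k → S0) → ZMod 2) (i j : ℕ) : (Fin k → S0) → ZMod 2 :=
  fun x => ∑ a ∈ Finset.HasAntidiagonal.antidiagonal i, ∑ b ∈ Finset.HasAntidiagonal.antidiagonal j,
    F3 k f a.1 b.1 x * F3 k g a.2 b.2 x

/-- `h⁽²⁾_{i,j} = μ₃ h⁽³⁾_{i,j}`. -/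
noncomputable def H2 (k : ℕ) (f g : (Fin k → S0) → ZMod 2) (i j : ℕ) :
    (Fin k → S0) → ZMod 2 :=
  muT k le3 (H3 k f g i j)

/-- `h⁽²⁾ᵢ(x) = h⁽²⁾_{i,j}(x)` for `j = |{q : x_q = D}|`. -/
noncomputable def H2i (k : ℕ) (f g : (Fin k → S0) → ZMod 2) (i : ℕ) :
    (Fin k → S0) → ZMod 2 :=
  fun x => H2 k f g i (cardD k x) x

/-- `h⁽¹⁾ᵢ = μ₂ h⁽²⁾ᵢ`. -/
noncomputable def H1i (k : ℕ) (f g : (Fin k → S0) → ZMod 2) (i : ℕ) :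
    (Fin k → S0) → ZMod 2 :=
  muT k le2 (H2i k f g i)

/-- `h⁽¹⁾(x) = h⁽¹⁾ᵢ(x)` for `i = |{q : x_q ∈ classC}|`. -/
noncomputable def H1 (k : ℕ) (f g : (Fin k → S0) → ZMod 2) : (Fin k → S0) → ZMod 2 :=
  fun x => H1i k f g (cardC k x) x

/-- The states `w ≤₃ x` and `u ≤₂ w` with `y ≤₁ u` exist iff `y ≤ x`, and are then unique. -/
theorem le_chain_iff (x w u y : S0) :
    (le3 w x = true ∧ le2 u w = true ∧ le1 y u = true) ↔
      le0 y x = true ∧ w = (if x = .D then y else x) ∧ u = (if x = .Cs then .Cs else y) := by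
  revert x w u y
  decide

/-- The componentwise version of `le_chain_iff`. -/
theorem le_chain_iff_pi {k : ℕ} (x w u y : Fin k → S0) :
    ((∀ q, le3 (w q) (x q) = true) ∧ (∀ q, le2 (u q) (w q) = true) ∧
        ∀ q, le1 (y q) (u q) = true) ↔
      (∀ q, le0 (y q) (x q) = true) ∧ w = (fun q => if x q = .D then y q else x q) ∧
        u = fun q => if x q = .Cs then .Cs else y q := by
  simp only [funext_iff, ← forall_and, le_chain_iff]

theorem cardD_ite (k : ℕ) (x y : Fin k → S0) :
    cardD k (fun q => if x q = .D then y q else x q) = cardDD k x y := by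
  unfold cardD cardDD
  congr 1
  ext q
  by_cases hq : x q = .D <;> simp [hq]

theorem cardC_ite (k : ℕ) (x y : Fin k → S0) (h : ∀ q, le0 (y q) (x q) = true) :
    cardC k (fun q => if x q = .Cs then .Cs else y q) = cardCC k x y := by
  unfold cardC cardCC
  congr 1
  ext q
  have key : ∀ a b : S0, le0 b a = true →
      (((if a = .Cs then S0.Cs else b) = .C ∨ (if a = .Cs then S0.Cs else b) = .Cp) ↔
        (a = .C ∨ a = .Cp) ∧ (b = .C ∨ b = .Cp)) := by decide
  simpa using key (x q) (y q) (h q)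

theorem zetaT_apply (k : ℕ) (r : S0 → S0 → Bool) (f : (Fin k → S0) → ZMod 2)
    (x : Fin k → S0) :
    zetaT k r f x = ∑ y, if ∀ q, r (y q) (x q) = true then f y else 0 := by
  simp [zetaT, zMat, Matrix.mulVec, dotProduct]

/-- `F3` as a single sum over chains `y ⪯₁ u ⪯₂ w ⪯₃ x`. -/
theorem F3_eq_sum_chain (k : ℕ) (f : (Fin k → S0) → ZMod 2) (i j : ℕ) (x : Fin k → S0) :
    F3 k f i j x = ∑ y, ∑ w, ∑ u,
      if ((∀ q, le3 (w q) (x q) = true) ∧ (∀ q, le2 (u q) (w q) = true) ∧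
        ∀ q, le1 (y q) (u q) = true) ∧ cardC k u = i ∧ cardD k w = j then f y else 0 := by
  rw [Finset.sum_comm]
  simp only [F3, zetaT_apply, restrD, restrC]
  refine Finset.sum_congr rfl fun w _ => ?_
  rw [Finset.sum_comm]
  simp only [ite_and]
  by_cases hw : ∀ q, le3 (w q) (x q) = true <;> by_cases hj : cardD k w = j <;>
    simp only [hw, hj, if_true, if_false, implies_true, Finset.sum_const_zero, ite_self]
  refine Finset.sum_congr rfl fun u _ => ?_
  split_ifs <;> simp

/-- `f⁽³⁾_{i,j}(x) = Σ_{y ⪯ x} [|{q : x_q ∈ classC ∧ y_q ∈ classC}| = i]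
· [|{q : x_q = D ∧ y_q = D}| = j] · f(y)`, the sum being over the componentwise order `⪯`
generated by `𝟎 < D < D* < C⁺ < C*` and `𝟎 < C < C⁺`. -/
theorem F3_eq_sum (k : ℕ) (f : (Fin k → S0) → ZMod 2) (i j : ℕ) (x : Fin k → S0) :
    F3 k f i j x =
      ∑ y : Fin k → S0,
        if (∀ q, le0 (y q) (x q) = true) ∧ cardCC k x y = i ∧ cardDD k x y = j then f y
        else 0 := by
  rw [F3_eq_sum_chain]
  refine Finset.sum_congr rfl fun y _ => ?_
  simp only [le_chain_iff_pi]
  by_cases h : ∀ q, le0 (y q) (x q) = true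
  · rw [Finset.sum_eq_single (fun q => if x q = .D then y q else x q),
      Finset.sum_eq_single (fun q => if x q = .Cs then .Cs else y q)]
    · simp only [cardC_ite k x y h, cardD_ite, and_true]
    · intro u _ hu
      simp [hu]
    · simp
    · intro w _ hw
      simp [hw]
    · simp
  · simp [h]
end

section
/- Let Z₀ = {N, D, C} and k ∈ ℕ. Then for all tables A₁, A₂ : Z₀^k → ℤ/2ℤ and every s ∈ Z₀^k: (A₁ ⊛ A₂)[s] = Σ_{i=0}^{c_s} (A₁^{(i)} ▷◁ A₂^{(c_s − i)})[s], where c_s = |s⁻¹(C)|. Here (A₁ ⊛ A₂)[s] = Σ_{s₁ ⋈ s₂ = s} A₁[s₁]·A₂[s₂] is the convolution over the componentwise operation ⋈ given by N ⋈ N = N, D ⋈ D = D, D ⋈ C = C ⋈ D = C, and ⊥ (contributing nothing) in the cases C ⋈ C, N ⋈ D, N ⋈ C; (B₁ ▷◁ B₂)[s] = Σ_{s₁ ∨ s₂ = s} B₁[s₁]·B₂[s₂] is the join product over the componentwise partial lattice join ∨ given by N ∨ N = N, D ∨ D = D, D ∨ C = C ∨ D = C, C ∨ C = C, with N having no join with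 D or C (such pairs contribute nothing); and A^{(i)}[t] = A[t] if |t⁻¹(C)| = i and 0 otherwise. -/
/-- The three states `N, D, C`. -/
inductive Z3 : Type
  | N | D | C
  deriving DecidableEq

instance : Fintype Z3 where
  elems := {Z3.N, Z3.D, Z3.C}
  complete := fun x => by cases x <;> simp

/-- The partial operation `⋈` on states: `N ⋈ N = N`, `D ⋈ D = D`, `D ⋈ C = C ⋈ D = C`,
and `⊥` (`none`) in the cases `C ⋈ C`, `N ⋈ D`, `N ⋈ C` (and symmetrically). -/
def bw : Z3 → Z3 → Option Z3
  | .N, .N => some .N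
  | .D, .D => some .D
  | .D, .C => some .C
  | .C, .D => some .C
  | _, _ => none

/-- The partial lattice join `∨` on states (`D < C`, `N` incomparable): `N ∨ N = N`,
`D ∨ D = D`, `D ∨ C = C ∨ D = C`, `C ∨ C = C`, and no join between `N` and `D` or `C`. -/
def vee : Z3 → Z3 → Option Z3
  | .N, .N => some .N
  | .D, .D => some .D
  | .D, .C => some .C
  | .C, .D => some .C
  | .C, .C => some .C
  | _, _ => none

/-- The convolution `(A₁ ⊛ A₂)[s] = Σ_{s₁ ⋈ s₂ = s} A₁[s₁] · A₂[s₂]` over the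
componentwise operation `⋈`; pairs where `⋈` is undefined contribute nothing. -/
def convZ (k : ℕ) (A₁ A₂ : (Fin k → Z3) → ZMod 2) : (Fin k → Z3) → ZMod 2 :=
  fun s => ∑ s₁ : Fin k → Z3, ∑ s₂ : Fin k → Z3,
    if ∀ q, bw (s₁ q) (s₂ q) = some (s q) then A₁ s₁ * A₂ s₂ else 0

/-- The join product `(B₁ ▷◁ B₂)[s] = Σ_{s₁ ∨ s₂ = s} B₁[s₁] · B₂[s₂]` over the
componentwise partial lattice join; pairs with no join contribute nothing. -/
def joinProdZ (k : ℕ) (B₁ B₂ : (Fin k → Z3) → ZMod 2) : (Fin k → Z3) → ZMod 2 :=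
  fun s => ∑ s₁ : Fin k → Z3, ∑ s₂ : Fin k → Z3,
    if ∀ q, vee (s₁ q) (s₂ q) = some (s q) then B₁ s₁ * B₂ s₂ else 0

/-- The filter `A^{(i)}`: `A` restricted to states with exactly `i` coordinates equal
to `C`. -/
def restrZ (k : ℕ) (i : ℕ) (A : (Fin k → Z3) → ZMod 2) : (Fin k → Z3) → ZMod 2 :=
  fun t => if (Finset.univ.filter fun q => t q = Z3.C).card = i then A t else 0

theorem vee_of_bw {a b c : Z3} (h : bw a b = some c) : vee a b = some c := by
  cases a <;> cases b <;> cases c <;> simp_all [bw, vee]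

theorem ite_le_of_vee {a b c : Z3} (h : vee a b = some c) :
    (if c = .C then 1 else 0) ≤ (if a = .C then 1 else 0) + (if b = .C then 1 else 0) := by
  cases a <;> cases b <;> cases c <;> simp_all [vee]

theorem bw_eq_some_iff_of_vee {a b c : Z3} (h : vee a b = some c) :
    bw a b = some c ↔
      (if c = .C then 1 else 0) = (if a = .C then 1 else 0) + (if b = .C then 1 else 0) := by
  cases a <;> cases b <;> cases c <;> simp_all [bw, vee]

/-- `s₁ ⋈ s₂ = s` holds exactly when `s₁ ∨ s₂ = s` and the numbers of `C`s add up. -/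
theorem forall_bw_iff {k : ℕ} (s₁ s₂ s : Fin k → Z3) :
    (∀ q, bw (s₁ q) (s₂ q) = some (s q)) ↔
      (∀ q, vee (s₁ q) (s₂ q) = some (s q)) ∧
        (Finset.univ.filter fun q => s q = Z3.C).card =
          (Finset.univ.filter fun q => s₁ q = Z3.C).card +
            (Finset.univ.filter fun q => s₂ q = Z3.C).card := by
  have key (hv : ∀ q, vee (s₁ q) (s₂ q) = some (s q)) :
      (Finset.univ.filter fun q => s q = Z3.C).card =
          (Finset.univ.filter fun q => s₁ q = Z3.C).card +
            (Finset.univ.filter fun q => s₂ q = Z3.C).card ↔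
        ∀ q, bw (s₁ q) (s₂ q) = some (s q) := by
    simp only [Finset.card_filter, ← Finset.sum_add_distrib]
    rw [Finset.sum_eq_sum_iff_of_le fun q _ => ite_le_of_vee (hv q)]
    simp only [Finset.mem_univ, true_imp_iff]
    exact forall_congr' fun q => (bw_eq_some_iff_of_vee (hv q)).symm
  constructor
  · intro h
    have hv := fun q => vee_of_bw (h q)
    exact ⟨hv, (key hv).2 h⟩
  · rintro ⟨hv, hc⟩
    exact (key hv).1 hc

/-- For all tables `A₁, A₂ : Z₀^k → ℤ/2ℤ` and every `s`:
`(A₁ ⊛ A₂)[s] = Σ_{i=0}^{c_s} (A₁^{(i)} ▷◁ A₂^{(c_s − i)})[s]` where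
`c_s = |s⁻¹(C)|`. -/
theorem conv_eq_sum_joinProd (k : ℕ) (A₁ A₂ : (Fin k → Z3) → ZMod 2) (s : Fin k → Z3) :
    convZ k A₁ A₂ s =
      ∑ i ∈ Finset.range ((Finset.univ.filter fun q => s q = Z3.C).card + 1),
        joinProdZ k (restrZ k i A₁)
          (restrZ k ((Finset.univ.filter fun q => s q = Z3.C).card - i) A₂) s := by
  unfold convZ joinProdZ
  simp_rw [Finset.sum_comm (s := Finset.range _)]
  refine Finset.sum_congr rfl fun s₁ _ => Finset.sum_congr rfl fun s₂ _ => ?_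
  rw [if_congr (forall_bw_iff s₁ s₂ s) rfl rfl]
  by_cases hv : ∀ q, vee (s₁ q) (s₂ q) = some (s q)
  · simp only [hv, implies_true, true_and, if_true, restrZ, ite_mul, zero_mul,
      Finset.sum_ite_eq, Finset.mem_range]
    split_ifs <;> first | omega | simp
  · simp [hv]
end
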